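/- arXiv:0707.0975 — 2 statements merged into one kernel-verified Lean document; each statement's English description precedes it below -/
import Mathlib

section
/- Let k be a field and C a k-coalgebra. On C^e = C ⊗ C define μ^e: C ⊗ C ⊗ C ⊗ C → C ⊗ C by μ^e(c ⊗ c̄ ⊗ d ⊗ d̄) = ε(c) ε(d̄) d ⊗ c̄. Let V ⊆ (C ⊗ C) ⊗ (C ⊗ C) be the subspace of elements Σ (c ⊗ c̄) ⊗ (d ⊗ d̄) satisfying Σ c_(1) ⊗ c̄ ⊗ c_(2) ⊗ d ⊗ d̄ = Σ c ⊗ c̄ ⊗ d̄_(1) ⊗ d ⊗ d̄_(2) (the cotensor product C^e ▢_C C^e). Then the two k-linear maps (C⊗C)⊗(C⊗C) → C ⊗ (C ⊗ C) given by Σ(c⊗c̄)⊗(d⊗d̄) ↦ Σ c_(1) ⊗ μ^e(c_(2) ⊗ c̄ ⊗ d ⊗ d̄) and Σ(c⊗c̄)⊗(d⊗d̄) ↦ Σ d̄_(2) ⊗ μ^e(c ⊗ c̄ ⊗ d ⊗ d̄_(1)) agree on V; explicitly, Σ c ⊗ d ε(d̄) ⊗ c̄ = Σ d̄ ⊗ d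 ε(c) ⊗ c̄ for every element of V. -/
/- STATEMENT 1: the multiplication μ^e of the co-enveloping coalgebra C^e = C ⊗ C_cop
factorizes through the cocenter: the two maps
  Σ(c⊗c̄)⊗(d⊗d̄) ↦ Σ c_(1) ⊗ μ^e(c_(2) ⊗ c̄ ⊗ d ⊗ d̄)  and
  Σ(c⊗c̄)⊗(d⊗d̄) ↦ Σ d̄_(2) ⊗ μ^e(c ⊗ c̄ ⊗ d ⊗ d̄_(1))
agree on the cotensor product C^e ▢_C C^e. -/

noncomputable section
open TensorProduct Coalgebra LinearMap

variable {k : Type*} [Field k]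
variable {C : Type*} [AddCommGroup C] [Module k C] [Coalgebra k C]

/-- the multiplication of the co-enveloping coalgebra:
`μ^e(c ⊗ c̄ ⊗ d ⊗ d̄) = ε(c) ε(d̄) d ⊗ c̄`. -/
def muE : (C ⊗[k] C) ⊗[k] (C ⊗[k] C) →ₗ[k] C ⊗[k] C :=
  (TensorProduct.map
      ((TensorProduct.lid k C).toLinearMap ∘ₗ LinearMap.rTensor C (counit (R := k)))
      ((TensorProduct.rid k C).toLinearMap ∘ₗ LinearMap.lTensor C (counit (R := k)))) ∘ₗ
    (tensorTensorTensorComm k C C C C).toLinearMap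

@[simp]
theorem muE_tmul (a b c d : C) :
    muE (k := k) ((a ⊗ₜ[k] b) ⊗ₜ[k] (c ⊗ₜ[k] d)) =
      (counit (R := k) a • c) ⊗ₜ[k] (counit (R := k) d • b) := by
  simp [muE]

/-- `x ⊗ c̄ ⊗ y ⊗ d ⊗ d̄ ↦ y ⊗ μ^e(x ⊗ c̄ ⊗ d ⊗ d̄)`. -/
def middleMuE : ((C ⊗[k] C) ⊗[k] C) ⊗[k] (C ⊗[k] C) →ₗ[k] C ⊗[k] (C ⊗[k] C) :=
  LinearMap.lTensor C muE ∘ₗ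
    (TensorProduct.leftComm k (C ⊗[k] C) C (C ⊗[k] C)).toLinearMap ∘ₗ
    (TensorProduct.assoc k (C ⊗[k] C) C (C ⊗[k] C)).toLinearMap

theorem middleMuE_tmul (x b y c d : C) :
    middleMuE (k := k) (((x ⊗ₜ[k] b) ⊗ₜ[k] y) ⊗ₜ[k] (c ⊗ₜ[k] d)) =
      y ⊗ₜ[k] ((counit (R := k) x • c) ⊗ₜ[k] (counit (R := k) d • b)) := by
  simp [middleMuE]

theorem sum_right_counit_smul_tmul {M : Type*} [AddCommGroup M] [Module k M]
    {ι : Type*} {c : C} (r : Coalgebra.Repr k c ι) (m : M) :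
    ∑ i ∈ r.index, r.left i ⊗ₜ[k] (counit (R := k) (r.right i) • m) = c ⊗ₜ[k] m := by
  have h := congrArg (TensorProduct.map (.id : C →ₗ[k] C) (LinearMap.toSpanSingleton k M m))
    (Coalgebra.sum_tmul_counit_eq r)
  simpa only [map_sum, TensorProduct.map_tmul, LinearMap.id_apply,
    LinearMap.toSpanSingleton_apply, one_smul] using h

theorem sum_left_counit_smul_tmul {M : Type*} [AddCommGroup M] [Module k M]
    {ι : Type*} {c : C} (r : Coalgebra.Repr k c ι) (m : M) :
    ∑ i ∈ r.index, r.right i ⊗ₜ[k] (counit (R := k) (r.left i) • m) = c ⊗ₜ[k] m := by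
  simp_rw [← TensorProduct.smul_tmul, ← TensorProduct.sum_tmul, Coalgebra.sum_counit_smul]

theorem lTensor_muE_comul_left (t : (C ⊗[k] C) ⊗[k] (C ⊗[k] C)) :
    (LinearMap.lTensor C (muE (k := k) (C := C)))
      ((TensorProduct.assoc k C (C ⊗[k] C) (C ⊗[k] C))
        ((LinearMap.rTensor (C ⊗[k] C)
          ((TensorProduct.assoc k C C C).toLinearMap ∘ₗ
           LinearMap.rTensor C (comul (R := k)))) t)) =
    middleMuE ((LinearMap.rTensor (C ⊗[k] C)
        ((TensorProduct.assoc k C C C).symm.toLinearMap ∘ₗ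
         LinearMap.lTensor C (TensorProduct.comm k C C).toLinearMap ∘ₗ
         (TensorProduct.assoc k C C C).toLinearMap ∘ₗ
         LinearMap.rTensor C (comul (R := k)))) t) := by
  induction t with
  | zero => simp
  | add x y hx hy => simp only [map_add, hx, hy]
  | tmul x y =>
    induction x with
    | zero => simp
    | add x x' hx hx' => simp only [TensorProduct.add_tmul, map_add, hx, hx']
    | tmul a b =>
      induction y with
      | zero => simp
      | add y y' hy hy' => simp only [TensorProduct.tmul_add, map_add, hy, hy']
      | tmul c d =>
        have r := Coalgebra.Repr.arbitrary k a
        simp only [LinearMap.rTensor_tmul, LinearMap.comp_apply, LinearEquiv.coe_coe, ← r.eq,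
          TensorProduct.sum_tmul, map_sum, TensorProduct.assoc_tmul, LinearMap.lTensor_tmul,
          TensorProduct.comm_tmul, TensorProduct.assoc_symm_tmul, muE_tmul, middleMuE_tmul]
        simp only [← TensorProduct.smul_tmul', sum_right_counit_smul_tmul,
          sum_left_counit_smul_tmul]

theorem lTensor_muE_comul_right (t : (C ⊗[k] C) ⊗[k] (C ⊗[k] C)) :
    (LinearMap.lTensor C (muE (k := k) (C := C)))
      ((TensorProduct.leftComm k (C ⊗[k] C) C (C ⊗[k] C))
        ((LinearMap.lTensor (C ⊗[k] C)
          ((TensorProduct.leftComm k C C C).toLinearMap ∘ₗ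
           LinearMap.lTensor C (TensorProduct.comm k C C).toLinearMap ∘ₗ
           LinearMap.lTensor C (comul (R := k)))) t)) =
    middleMuE ((TensorProduct.assoc k (C ⊗[k] C) C (C ⊗[k] C)).symm
        ((LinearMap.lTensor (C ⊗[k] C)
          ((TensorProduct.leftComm k C C C).toLinearMap ∘ₗ
           LinearMap.lTensor C (comul (R := k)))) t)) := by
  induction t with
  | zero => simp
  | add x y hx hy => simp only [map_add, hx, hy]
  | tmul x y =>
    induction x with
    | zero => simp
    | add x x' hx hx' => simp only [TensorProduct.add_tmul, map_add, hx, hx']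
    | tmul a b =>
      induction y with
      | zero => simp
      | add y y' hy hy' => simp only [TensorProduct.tmul_add, map_add, hy, hy']
      | tmul c d =>
        have r := Coalgebra.Repr.arbitrary k d
        simp only [LinearMap.comp_apply, LinearEquiv.coe_coe, ← r.eq, LinearMap.lTensor_tmul,
          TensorProduct.tmul_sum, map_sum, TensorProduct.leftComm_tmul, TensorProduct.comm_tmul,
          TensorProduct.assoc_symm_tmul, muE_tmul, middleMuE_tmul]
        simp only [TensorProduct.tmul_smul (M := C) (N := C), sum_right_counit_smul_tmul,
          sum_left_counit_smul_tmul]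

theorem coenveloping_coTakeuchi
    (t : (C ⊗[k] C) ⊗[k] (C ⊗[k] C))
    -- t ∈ C^e ▢_C C^e :  Σ c_(1) ⊗ c̄ ⊗ c_(2) ⊗ d ⊗ d̄ = Σ c ⊗ c̄ ⊗ d̄_(1) ⊗ d ⊗ d̄_(2)
    (ht : (LinearMap.rTensor (C ⊗[k] C)
        ((TensorProduct.assoc k C C C).symm.toLinearMap ∘ₗ
         LinearMap.lTensor C (TensorProduct.comm k C C).toLinearMap ∘ₗ
         (TensorProduct.assoc k C C C).toLinearMap ∘ₗ
         LinearMap.rTensor C (comul (R := k)))) t =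
      (TensorProduct.assoc k (C ⊗[k] C) C (C ⊗[k] C)).symm
        ((LinearMap.lTensor (C ⊗[k] C)
          ((TensorProduct.leftComm k C C C).toLinearMap ∘ₗ
           LinearMap.lTensor C (comul (R := k)))) t)) :
    -- Σ c_(1) ⊗ μ^e(c_(2) ⊗ c̄ ⊗ d ⊗ d̄) = Σ d̄_(2) ⊗ μ^e(c ⊗ c̄ ⊗ d ⊗ d̄_(1))
    (LinearMap.lTensor C (muE (k := k) (C := C)))
      ((TensorProduct.assoc k C (C ⊗[k] C) (C ⊗[k] C))
        ((LinearMap.rTensor (C ⊗[k] C)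
          ((TensorProduct.assoc k C C C).toLinearMap ∘ₗ
           LinearMap.rTensor C (comul (R := k)))) t)) =
    (LinearMap.lTensor C (muE (k := k) (C := C)))
      ((TensorProduct.leftComm k (C ⊗[k] C) C (C ⊗[k] C))
        ((LinearMap.lTensor (C ⊗[k] C)
          ((TensorProduct.leftComm k C C C).toLinearMap ∘ₗ
           LinearMap.lTensor C (TensorProduct.comm k C C).toLinearMap ∘ₗ
           LinearMap.lTensor C (comul (R := k)))) t)) := by
  rw [lTensor_muE_comul_left, ht, lTensor_muE_comul_right]
end
end

section
/- Let k be a field, H and C k-coalgebras, α: H → C a coalgebra map, and η: C → H a k-linear map satisfying Δ_H(η(c)) = η(c)_(1) ⊗ η(α(η(c)_(2))), ε_H(η(c)) = ε_C(c), and the left-comodule-map property α(η(c)_(1)) ⊗ η(c)_(2) = c_(1) ⊗ η(c_(2)) for all c ∈ C. Define δ_C: C → H ⊗ C by δ_C(c) = η(c)_(1) ⊗ α(η(c)_(2)). Then δ_C is a coassociative counital coaction: (Δ_H ⊗ id_C) ∘ δ_C = (id_H ⊗ δ_C) ∘ δ_C and (ε_H ⊗ id_C) ∘ δ_C = id_C.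 -/
/- STATEMENT 5: the map δ_C(c) = η(c)_(1) ⊗ α(η(c)_(2)) coming from the
bicoalgebroid unit η : C → H is a coassociative counital H-coaction on C. -/

noncomputable section
open TensorProduct Coalgebra LinearMap

theorem unit_coaction_on_base
    {k : Type*} [Field k]
    {H C : Type*}
    [AddCommGroup H] [Module k H] [Coalgebra k H]
    [AddCommGroup C] [Module k C] [Coalgebra k C]
    (α : H →ₗ[k] C) (η : C →ₗ[k] H)
    -- α is a coalgebra map
    (hα1 : ∀ h : H, comul (α h) = TensorProduct.map α α (comul h))
    (hα2 : ∀ h : H, counit (α h) = (counit h : k))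
    -- Δ_H(η(c)) = η(c)_(1) ⊗ η(α(η(c)_(2)))
    (hη1 : ∀ c : C, comul (η c) =
      (LinearMap.lTensor H (η ∘ₗ α)) (comul (η c)))
    -- ε_H(η(c)) = ε_C(c)
    (hη2 : ∀ c : C, (counit (η c) : k) = counit c)
    -- η is a left C-comodule map: α(η(c)_(1)) ⊗ η(c)_(2) = c_(1) ⊗ η(c_(2))
    (hη3 : ∀ c : C, (LinearMap.rTensor H α) (comul (η c)) =
      (LinearMap.lTensor C η) (comul c))
    -- δ_C(c) = η(c)_(1) ⊗ α(η(c)_(2))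
    (δC : C →ₗ[k] H ⊗[k] C)
    (hδ : δC = LinearMap.lTensor H α ∘ₗ comul (R := k) ∘ₗ η) :
    -- coassociativity: (Δ_H ⊗ id) ∘ δ_C = (id ⊗ δ_C) ∘ δ_C
    (∀ c : C, (TensorProduct.assoc k H H C)
        ((LinearMap.rTensor C (comul (R := k))) (δC c)) =
      (LinearMap.lTensor H δC) (δC c)) ∧
    -- counitality: (ε_H ⊗ id) ∘ δ_C = id
    (∀ c : C, (TensorProduct.lid k C)
        ((LinearMap.rTensor C (counit (R := k) (A := H))) (δC c)) = c) := by
  subst hδ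
  have hη2' : (counit : H →ₗ[k] k) ∘ₗ η = counit := LinearMap.ext hη2
  refine ⟨fun c => ?_, fun c => ?_⟩
  · have hR : lTensor H (lTensor H α ∘ₗ comul ∘ₗ η) (lTensor H α (comul (η c))) =
        lTensor H (lTensor H α ∘ₗ comul) (lTensor H (η ∘ₗ α) (comul (η c))) := by
      rw [← lTensor_comp_apply, ← lTensor_comp_apply]
      rfl
    have hL : ∀ x : H ⊗[k] H, TensorProduct.assoc k H H C
        (rTensor C comul (lTensor H α x)) =
        lTensor H (lTensor H α) (TensorProduct.assoc k H H H (rTensor H comul x)) := by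
      intro x
      rw [← LinearMap.comp_apply (rTensor C comul), rTensor_comp_lTensor,
        ← lTensor_comp_rTensor, LinearMap.comp_apply]
      generalize rTensor H comul x = y
      rw [lTensor_tensor]
      simp
    simp only [LinearMap.comp_apply]
    rw [hR, ← hη1, hL, coassoc_apply, lTensor_comp_apply]
  · have hα : α (η c) = c := by
      have h := congrArg (TensorProduct.rid k C ∘ lTensor C counit) (hη3 c)
      simp only [Function.comp_apply] at h
      rwa [← lTensor_comp_apply, hη2', lTensor_counit_comul,
        ← LinearMap.comp_apply (lTensor C counit), lTensor_comp_rTensor,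
        ← rTensor_comp_lTensor, LinearMap.comp_apply, lTensor_counit_comul,
        rTensor_tmul, TensorProduct.rid_tmul, TensorProduct.rid_tmul, one_smul, one_smul] at h
    simp only [LinearMap.comp_apply]
    rw [← LinearMap.comp_apply (rTensor C counit), rTensor_comp_lTensor,
      ← lTensor_comp_rTensor, LinearMap.comp_apply, rTensor_counit_comul,
      lTensor_tmul, TensorProduct.lid_tmul, one_smul, hα]
end
end
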